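/- Let n ≥ 1 and 1 ≤ q ≤ ∞. There exists a constant C = C(n, q) > 0 such that for every t > 0 and every measurable function b : ℝⁿ₊ → ℝ with ∫_{ℝⁿ₊} yₙ |b(y)| dy < ∞, all third-order spatial partial derivatives of x ↦ E(t)b(x) exist on ℝⁿ₊ and satisfy ‖∂_i∂_j∂_k E(t)b‖_{L^q(ℝⁿ₊)} ≤ C t^{−2 − (n/2)(1 − 1/q)} ∫_{ℝⁿ₊} yₙ |b(y)| dy for all 1 ≤ i, j, k ≤ n. -/

import Mathlib

open MeasureTheory ENNReal

noncomputable section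

/-- Points of `ℝⁿ` with `n = m + 1`, written as pairs `x = (x′, xₙ)`. -/
abbrev HalfSpacePt (m : ℕ) := (Fin m → ℝ) × ℝ

/-- The Gauss kernel `G_t(x) = (4πt)^{-n/2} exp(-|x|²/(4t))` in dimension `n = m + 1`. -/
def gauss (m : ℕ) (t : ℝ) (x : HalfSpacePt m) : ℝ :=
  (4 * Real.pi * t) ^ (-((m : ℝ) + 1) / 2) *
    Real.exp (-((∑ i, x.1 i ^ 2) + x.2 ^ 2) / (4 * t))

/-- The open upper half-space `ℝⁿ₊ = {x : xₙ > 0}`. -/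
def halfSpace (m : ℕ) : Set (HalfSpacePt m) := {x | 0 < x.2}

/-- The Dirichlet heat operator
`E(t)f(x) = ∫_{ℝⁿ₊} [G_t(x′−y′, xₙ−yₙ) − G_t(x′−y′, xₙ+yₙ)] f(y) dy`. -/
def Eheat (m : ℕ) (t : ℝ) (f : HalfSpacePt m → ℝ) (x : HalfSpacePt m) : ℝ :=
  ∫ y in halfSpace m,
    (gauss m t (x.1 - y.1, x.2 - y.2) - gauss m t (x.1 - y.1, x.2 + y.2)) * f y

/-- The Neumann heat operator
`F(t)f(x) = ∫_{ℝⁿ₊} [G_t(x′−y′, xₙ−yₙ) + G_t(x′−y′, xₙ+yₙ)] f(y) dy`. -/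
def Fheat (m : ℕ) (t : ℝ) (f : HalfSpacePt m → ℝ) (x : HalfSpacePt m) : ℝ :=
  ∫ y in halfSpace m,
    (gauss m t (x.1 - y.1, x.2 - y.2) + gauss m t (x.1 - y.1, x.2 + y.2)) * f y

/-- The Neumann potential operator `𝒩f(x) = ∫₀^∞ F(τ)f(x) dτ`. -/
def neumannPotential (m : ℕ) (f : HalfSpacePt m → ℝ) (x : HalfSpacePt m) : ℝ :=
  ∫ τ in Set.Ioi (0 : ℝ), Fheat m τ f x

/-- `∂_{xₙ} G_t`, the partial derivative of the Gauss kernel in the last coordinate. -/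
def gaussDn (m : ℕ) (t : ℝ) (z : HalfSpacePt m) : ℝ :=
  deriv (fun w => gauss m t (z.1, w)) z.2

/-- The `i`-th standard coordinate vector of `ℝⁿ`, `n = m + 1` (the case `i = n`
being the inward normal direction `eₙ`). -/
def coordVec (m : ℕ) (i : Fin (m + 1)) : HalfSpacePt m :=
  if h : (i : ℕ) < m then (Pi.single ⟨i, h⟩ 1, 0) else (0, 1)


open scoped SchwartzMap

lemma one_add_pow_mul_exp_neg_sq_le {c : ℝ} (hc : 0 < c) (N : ℕ) {r : ℝ} (hr : 0 ≤ r) :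
    (1 + r) ^ N * Real.exp (-(c * r ^ 2)) ≤ N.factorial * Real.exp (1 + 1 / (4 * c)) := by
  have h1 : (1 + r) ^ N ≤ N.factorial * Real.exp (1 + r) := by
    have := Real.pow_div_factorial_le_exp (1 + r) (by positivity) N
    rwa [div_le_iff₀' (by positivity)] at this
  have h2 : 1 + r + -(c * r ^ 2) ≤ 1 + 1 / (4 * c) := by
    have : 1 / (4 * c) - r + c * r ^ 2 = (2 * c * r - 1) ^ 2 / (4 * c) := by
      field_simp; ring
    have h3 : 0 ≤ (2 * c * r - 1) ^ 2 / (4 * c) := by positivity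
    linarith
  calc (1 + r) ^ N * Real.exp (-(c * r ^ 2))
      ≤ N.factorial * Real.exp (1 + r) * Real.exp (-(c * r ^ 2)) := by gcongr
    _ = N.factorial * Real.exp (1 + r + -(c * r ^ 2)) := by rw [Real.exp_add _ (-(c * r ^ 2)), mul_assoc]
    _ ≤ _ := by gcongr

/-- The function `exp (-Q)` as a Schwartz map, when `Q` has temperate growth and grows at least
quadratically. -/
def expNegSchwartz {V : Type*} [NormedAddCommGroup V] [NormedSpace ℝ V] (Q : V → ℝ)
    (hQ : Q.HasTemperateGrowth) (c : ℝ) (hc : 0 < c) (hlow : ∀ x, c * ‖x‖ ^ 2 ≤ Q x) :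
    𝓢(V, ℝ) where
  toFun x := Real.exp (-Q x)
  smooth' := Real.contDiff_exp.comp hQ.1.neg
  decay' k n := by
    obtain ⟨l, C, hC, hb⟩ := hQ.neg.norm_iteratedFDeriv_le_uniform n
    refine ⟨n.factorial * (C + 1) ^ n *
      ((k + l * n).factorial * Real.exp (1 + 1 / (4 * c))), fun x => ?_⟩
    have hD1 : 1 ≤ (C + 1) * (1 + ‖x‖) ^ l :=
      one_le_mul_of_one_le_of_one_le (by linarith)
        (one_le_pow₀ (by linarith [norm_nonneg x]))
    have h := norm_iteratedFDeriv_comp_le (g := Real.exp) (f := -Q) (N := n) (n := n)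
      (x := x) (C := Real.exp (-Q x)) (D := (C + 1) * (1 + ‖x‖) ^ l)
      Real.contDiff_exp (hQ.neg.1.of_le (mod_cast le_top)) le_rfl
      (fun i _ => by
        rw [norm_iteratedFDeriv_eq_norm_iteratedDeriv, iteratedDeriv_eq_iterate,
          Real.iter_deriv_exp]
        simp)
      (fun i hi hin => by
        refine (hb i hin x).trans ?_
        refine le_trans ?_ (le_self_pow₀ hD1 (by omega))
        gcongr
        linarith)
    have hx : ‖x‖ ^ k ≤ (1 + ‖x‖) ^ k := by gcongr; linarith
    calc ‖x‖ ^ k * ‖iteratedFDeriv ℝ n (fun x => Real.exp (-Q x)) x‖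
        ≤ (1 + ‖x‖) ^ k * (n.factorial * Real.exp (-(c * ‖x‖ ^ 2)) *
            ((C + 1) * (1 + ‖x‖) ^ l) ^ n) := by
          refine mul_le_mul hx (h.trans ?_) (norm_nonneg _) (by positivity)
          gcongr
          exact hlow x
      _ = n.factorial * (C + 1) ^ n *
            ((1 + ‖x‖) ^ (k + l * n) * Real.exp (-(c * ‖x‖ ^ 2))) := by
          rw [mul_pow, ← pow_mul, pow_add]; ring
      _ ≤ _ := by
          exact mul_le_mul_of_nonneg_left
            (one_add_pow_mul_exp_neg_sq_le hc _ (norm_nonneg x)) (by positivity)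

lemma hasTemperateGrowth_normSq_div_four (m : ℕ) :
    (fun z : HalfSpacePt m => ((∑ i, z.1 i ^ 2) + z.2 ^ 2) / 4).HasTemperateGrowth := by
  have h1 : ∀ i, (fun z : HalfSpacePt m => z.1 i ^ 2).HasTemperateGrowth := fun i =>
    ((ContinuousLinearMap.proj (R := ℝ) i).comp
      (ContinuousLinearMap.fst ℝ (Fin m → ℝ) ℝ)).hasTemperateGrowth.pow 2
  have h2 : (fun z : HalfSpacePt m => z.2 ^ 2).HasTemperateGrowth :=
    (ContinuousLinearMap.snd ℝ (Fin m → ℝ) ℝ).hasTemperateGrowth.pow 2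
  exact ((Function.HasTemperateGrowth.sum fun i _ => h1 i).add h2).mul
    (Function.HasTemperateGrowth.const ((4 : ℝ)⁻¹))

lemma norm_sq_le_normSq {m : ℕ} (z : HalfSpacePt m) :
    1 / 4 * ‖z‖ ^ 2 ≤ ((∑ i, z.1 i ^ 2) + z.2 ^ 2) / 4 := by
  have hs : 0 ≤ ∑ i, z.1 i ^ 2 := Finset.sum_nonneg fun i _ => sq_nonneg _
  have h : ‖z‖ ≤ √((∑ i, z.1 i ^ 2) + z.2 ^ 2) := by
    rw [Prod.norm_def, max_le_iff]
    constructor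
    · rw [pi_norm_le_iff_of_nonneg (Real.sqrt_nonneg _)]
      intro i
      apply Real.le_sqrt_of_sq_le
      have := Finset.single_le_sum (f := fun i => z.1 i ^ 2)
        (fun i _ => sq_nonneg _) (Finset.mem_univ i)
      simp only [Real.norm_eq_abs, sq_abs]
      linarith [sq_nonneg z.2]
    · apply Real.le_sqrt_of_sq_le
      simp only [Real.norm_eq_abs, sq_abs]
      linarith
  have h2 := pow_le_pow_left₀ (norm_nonneg z) h 2
  rw [Real.sq_sqrt (by positivity)] at h2
  linarith

/-- The Gaussian `z ↦ exp (-|z|² / 4)` as a Schwartz map. -/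
def gaussSchwartz (m : ℕ) : 𝓢(HalfSpacePt m, ℝ) :=
  expNegSchwartz _ (hasTemperateGrowth_normSq_div_four m) (1 / 4) (by norm_num)
    norm_sq_le_normSq

lemma gaussSchwartz_apply (m : ℕ) (z : HalfSpacePt m) :
    gaussSchwartz m z = Real.exp (-(((∑ i, z.1 i ^ 2) + z.2 ^ 2) / 4)) := rfl

lemma gauss_eq (m : ℕ) {t : ℝ} (ht : 0 < t) (z : HalfSpacePt m) :
    gauss m t z = (4 * Real.pi * t) ^ (-((m : ℝ) + 1) / 2) *
      gaussSchwartz m ((√t)⁻¹ • z) := by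
  rw [gauss, gaussSchwartz_apply]
  congr 2
  have h : (√t)⁻¹ ^ 2 = t⁻¹ := by rw [inv_pow, Real.sq_sqrt ht.le]
  simp only [Prod.smul_fst, Prod.smul_snd, Pi.smul_apply, smul_eq_mul, mul_pow, h,
    ← Finset.mul_sum]
  field_simp

section

variable {V F Ω : Type*} [NormedAddCommGroup V] [NormedSpace ℝ V] [NormedAddCommGroup F]
  [NormedSpace ℝ F] [MeasurableSpace Ω]

/-- The rescaled convolution `x ↦ ∫ w(ω) f(a (x - φ(ω))) dν(ω)`. -/
def scaledConv (ν : Measure Ω) (w : Ω → ℝ) (φ : Ω → V) (a : ℝ) (f : V → F) (x : V) : F :=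
  ∫ ω, w ω • f (a • (x - φ ω)) ∂ν

variable {ν : Measure Ω} {w : Ω → ℝ} {φ : Ω → V}

lemma integrable_smul_schwartz_comp (hw : Integrable w ν) (hφ : AEStronglyMeasurable φ ν)
    (a : ℝ) (f : 𝓢(V, F)) (x : V) :
    Integrable (fun ω => w ω • f (a • (x - φ ω))) ν := by
  refine hw.smul_bdd (C := SchwartzMap.seminorm ℝ 0 0 f) ?_ ?_
  · exact f.continuous.comp_aestronglyMeasurable
      ((aestronglyMeasurable_const.sub hφ).const_smul a)
  · exact .of_forall fun ω => f.norm_le_seminorm ℝ _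

lemma hasFDerivAt_scaledConv (hw : Integrable w ν) (hφ : AEStronglyMeasurable φ ν)
    (a : ℝ) (f : 𝓢(V, F)) (x : V) :
    HasFDerivAt (scaledConv ν w φ a f)
      (a • scaledConv ν w φ a (SchwartzMap.fderivCLM ℝ V F f) x) x := by
  have hf : ∀ (x : V) ω, HasFDerivAt (fun x => w ω • f (a • (x - φ ω)))
      (a • w ω • SchwartzMap.fderivCLM ℝ V F f (a • (x - φ ω))) x := by
    intro x ω
    have h1 : HasFDerivAt (fun x : V => a • (x - φ ω)) (a • ContinuousLinearMap.id ℝ V) x :=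
      ((hasFDerivAt_id x).sub_const (φ ω)).const_smul a
    have h2 := (((f.differentiable (x := a • (x - φ ω))).hasFDerivAt).comp x h1).const_smul (w ω)
    refine h2.congr_fderiv ?_
    ext v
    simp [smul_comm a]
  unfold scaledConv
  rw [← integral_smul]
  refine hasFDerivAt_integral_of_dominated_of_fderiv_le (𝕜 := ℝ)
    (F := fun x ω => w ω • f (a • (x - φ ω))) (s := Set.univ)
    (bound := fun ω => |a| * (|w ω| * SchwartzMap.seminorm ℝ 0 0 (SchwartzMap.fderivCLM ℝ V F f)))
    Filter.univ_mem
    (.of_forall fun x => (integrable_smul_schwartz_comp hw hφ a f x).aestronglyMeasurable)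
    (integrable_smul_schwartz_comp hw hφ a f x)
    ((integrable_smul_schwartz_comp hw hφ a _ x).aestronglyMeasurable.const_smul a)
    (.of_forall fun ω x _ => ?_)
    ((hw.abs.mul_const _).const_mul _)
    (.of_forall fun ω x _ => hf x ω)
  rw [norm_smul, norm_smul, Real.norm_eq_abs, Real.norm_eq_abs]
  gcongr
  exact SchwartzMap.norm_le_seminorm ℝ _ _

lemma differentiable_scaledConv (hw : Integrable w ν) (hφ : AEStronglyMeasurable φ ν)
    (a : ℝ) (f : 𝓢(V, F)) : Differentiable ℝ (scaledConv ν w φ a f) := fun x =>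
  (hasFDerivAt_scaledConv hw hφ a f x).differentiableAt

lemma fderiv_const_smul_scaledConv (hw : Integrable w ν) (hφ : AEStronglyMeasurable φ ν)
    (a c : ℝ) (f : 𝓢(V, F)) :
    fderiv ℝ (c • scaledConv ν w φ a f) =
      (c * a) • scaledConv ν w φ a (SchwartzMap.fderivCLM ℝ V F f) := by
  ext1 x
  rw [((hasFDerivAt_scaledConv hw hφ a f x).const_smul c).fderiv, smul_smul]
  rfl

lemma norm_scaledConv_le (hw : Integrable w ν) (a : ℝ) (f : 𝓢(V, F)) (x : V) :
    ‖scaledConv ν w φ a f x‖ ≤ SchwartzMap.seminorm ℝ 0 0 f * ∫ ω, |w ω| ∂ν := by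
  rw [← integral_const_mul]
  refine norm_integral_le_of_norm_le (hw.abs.const_mul _) (.of_forall fun ω => ?_)
  rw [norm_smul, Real.norm_eq_abs, mul_comm]
  gcongr
  exact SchwartzMap.norm_le_seminorm ℝ _ _

lemma lintegral_enorm_scaledConv_le [MeasurableSpace V] [BorelSpace V] [FiniteDimensional ℝ V]
    {μ : Measure V} [μ.IsAddHaarMeasure] [SFinite ν]
    (hw : Integrable w ν) (hφ : Measurable φ)
    {a : ℝ} (ha : 0 < a) (f : 𝓢(V, F)) :
    ∫⁻ x, ‖scaledConv ν w φ a f x‖ₑ ∂μ ≤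
      ENNReal.ofReal ((a ^ Module.finrank ℝ V)⁻¹ * (∫ z, ‖f z‖ ∂μ) * ∫ ω, |w ω| ∂ν) := by
  have hfm : Measurable fun z => ‖f z‖ₑ := f.continuous.enorm.measurable
  have hscale : ∀ v : V, ∫⁻ x, ‖f (a • (x - v))‖ₑ ∂μ =
      ENNReal.ofReal ((a ^ Module.finrank ℝ V)⁻¹ * ∫ z, ‖f z‖ ∂μ) := by
    intro v
    rw [lintegral_sub_right_eq_self (fun x => ‖f (a • x)‖ₑ) v,
      ← lintegral_map (f := fun z => ‖f z‖ₑ) hfm (measurable_const_smul a),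
      Measure.map_addHaar_smul μ ha.ne', lintegral_smul_measure,
      ← ofReal_integral_norm_eq_lintegral_enorm f.integrable, smul_eq_mul,
      ← ENNReal.ofReal_mul (abs_nonneg _), abs_of_pos (by positivity)]
  calc ∫⁻ x, ‖scaledConv ν w φ a f x‖ₑ ∂μ
      ≤ ∫⁻ x, ∫⁻ ω, ‖w ω‖ₑ * ‖f (a • (x - φ ω))‖ₑ ∂ν ∂μ := by
        refine lintegral_mono fun x => (enorm_integral_le_lintegral_enorm _).trans_eq ?_
        simp_rw [enorm_smul]
    _ = ∫⁻ ω, ∫⁻ x, ‖w ω‖ₑ * ‖f (a • (x - φ ω))‖ₑ ∂μ ∂ν := by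
        refine lintegral_lintegral_swap ?_
        exact (hw.aestronglyMeasurable.enorm.comp_snd).mul
          (hfm.comp ((measurable_fst.sub (hφ.comp measurable_snd)).const_smul a)).aemeasurable
    _ = ∫⁻ ω, ‖w ω‖ₑ *
          ENNReal.ofReal ((a ^ Module.finrank ℝ V)⁻¹ * ∫ z, ‖f z‖ ∂μ) ∂ν := by
        refine lintegral_congr fun ω => ?_
        rw [lintegral_const_mul' _ _ enorm_ne_top, hscale]
    _ = _ := by
        rw [lintegral_mul_const'' _ hw.aestronglyMeasurable.enorm,
          ← ofReal_integral_norm_eq_lintegral_enorm hw, ← ENNReal.ofReal_mul (by positivity),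
          mul_comm]
        simp only [Real.norm_eq_abs]

end

lemma eLpNorm_le_of_enorm_le_of_lintegral_le {α F : Type*} [MeasurableSpace α]
    [NormedAddCommGroup F] {μ : Measure α} {f : α → F} {S R : ℝ≥0∞} {q : ℝ≥0∞} (hq : 1 ≤ q)
    (hS : S ≠ ⊤)
    (hsup : ∀ x, ‖f x‖ₑ ≤ S) (hint : ∫⁻ x, ‖f x‖ₑ ∂μ ≤ R * S) :
    eLpNorm f q μ ≤ R ^ q⁻¹.toReal * S := by
  rcases eq_or_ne q ⊤ with rfl | hqt
  · simpa using eLpNormEssSup_le_of_ae_enorm_bound (.of_forall hsup)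
  have hp : 1 ≤ q.toReal := by
    simpa using ENNReal.toReal_mono hqt hq
  have hp0 : 0 < q.toReal := by linarith
  rw [eLpNorm_eq_lintegral_rpow_enorm_toReal (by positivity) hqt, ENNReal.toReal_inv, one_div]
  calc (∫⁻ x, ‖f x‖ₑ ^ q.toReal ∂μ) ^ q.toReal⁻¹
      ≤ (R * S ^ q.toReal) ^ q.toReal⁻¹ := by
        gcongr
        calc ∫⁻ x, ‖f x‖ₑ ^ q.toReal ∂μ
            ≤ ∫⁻ x, S ^ (q.toReal - 1) * ‖f x‖ₑ ∂μ := by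
              refine lintegral_mono fun x => ?_
              calc ‖f x‖ₑ ^ q.toReal = ‖f x‖ₑ ^ (q.toReal - 1) * ‖f x‖ₑ := by
                    conv_rhs => rw [← ENNReal.rpow_one ‖f x‖ₑ, ← ENNReal.rpow_mul, one_mul,
                      ← ENNReal.rpow_add_of_nonneg _ _ (by linarith) zero_le_one]
                    simp
                _ ≤ _ := by
                    gcongr
                    exact hsup x
          _ = S ^ (q.toReal - 1) * ∫⁻ x, ‖f x‖ₑ ∂μ :=
              lintegral_const_mul' _ _ (ENNReal.rpow_ne_top_of_nonneg (by linarith) hS)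
          _ ≤ S ^ (q.toReal - 1) * (R * S) := by gcongr
          _ = R * S ^ q.toReal := by
              conv_rhs => rw [show q.toReal = (q.toReal - 1) + 1 by ring,
                ENNReal.rpow_add_of_nonneg _ _ (by linarith) zero_le_one, ENNReal.rpow_one]
              ring
    _ = R ^ q.toReal⁻¹ * S := by
        rw [ENNReal.mul_rpow_of_nonneg _ _ (by positivity), ← ENNReal.rpow_mul,
          mul_inv_cancel₀ hp0.ne', ENNReal.rpow_one]

/-- The normal derivative of the Gaussian `z ↦ exp (-|z|² / 4)` as a Schwartz map. -/
def gaussSchwartzDn (m : ℕ) : 𝓢(HalfSpacePt m, ℝ) :=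
  SchwartzMap.evalCLM ℝ (HalfSpacePt m) ℝ ((0, 1) : HalfSpacePt m)
    (SchwartzMap.fderivCLM ℝ (HalfSpacePt m) ℝ (gaussSchwartz m))

lemma gaussSchwartzDn_apply (m : ℕ) (z : HalfSpacePt m) :
    gaussSchwartzDn m z = fderiv ℝ (gaussSchwartz m) z (0, 1) := rfl

lemma gauss_sub_gauss_eq (m : ℕ) {t : ℝ} (ht : 0 < t) (x y : HalfSpacePt m) :
    gauss m t (x.1 - y.1, x.2 - y.2) - gauss m t (x.1 - y.1, x.2 + y.2) =
      ∫ s in Set.Ioc (-1 : ℝ) 1,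
        -((4 * Real.pi * t) ^ (-((m : ℝ) + 1) / 2) * (√t)⁻¹) *
          (y.2 * gaussSchwartzDn m ((√t)⁻¹ • (x - (y.1, s * y.2)))) := by
  set c := (4 * Real.pi * t) ^ (-((m : ℝ) + 1) / 2)
  set a := (√t)⁻¹
  have hderiv : ∀ s : ℝ, HasDerivAt
      (fun s : ℝ => c * gaussSchwartz m (a • (x - (y.1, s * y.2))))
      (-(c * a) * (y.2 * gaussSchwartzDn m (a • (x - (y.1, s * y.2))))) s := by
    intro s
    have h1 : HasDerivAt (fun s : ℝ => a • (x - (y.1, s * y.2)))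
        (a • -((0, y.2) : HalfSpacePt m)) s := by
      refine HasDerivAt.const_smul a (HasDerivAt.const_sub x ?_)
      simpa using (hasDerivAt_const s y.1).prodMk ((hasDerivAt_id s).mul_const y.2)
    have h2 := ((gaussSchwartz m).differentiable
      (x := a • (x - (y.1, s * y.2)))).hasFDerivAt.comp_hasDerivAt s h1
    refine (h2.const_mul c).congr_deriv ?_
    have h3 : a • -((0, y.2) : HalfSpacePt m) = (-(a * y.2)) • ((0, 1) : HalfSpacePt m) := by
      ext <;> simp
    rw [h3, map_smul, gaussSchwartzDn_apply, smul_eq_mul]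
    ring
  rw [← intervalIntegral.integral_of_le (by norm_num),
    intervalIntegral.integral_eq_sub_of_hasDerivAt (fun s _ => hderiv s)
      (Continuous.intervalIntegrable (by fun_prop) _ _), gauss_eq m ht, gauss_eq m ht]
  congr 4 <;> simp [Prod.sub_def]

section

variable (m : ℕ) (b : HalfSpacePt m → ℝ)

/-- The measure on `ℝⁿ₊ × (-1, 1]` over which the Dirichlet heat operator is written as a
convolution. -/
def dirichletMeasure : Measure (HalfSpacePt m × ℝ) :=
  (volume.restrict (halfSpace m)).prod (volume.restrict (Set.Ioc (-1 : ℝ) 1))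

/-- The weight `yₙ b(y)`. -/
def dirichletWeight (p : HalfSpacePt m × ℝ) : ℝ := p.1.2 * b p.1

/-- The map `(y, s) ↦ (y′, s yₙ)`. -/
def dirichletPoint (p : HalfSpacePt m × ℝ) : HalfSpacePt m := (p.1.1, p.2 * p.1.2)

instance : SFinite (dirichletMeasure m) := by
  unfold dirichletMeasure; infer_instance

lemma measurable_dirichletPoint : Measurable (dirichletPoint m) := by
  unfold dirichletPoint; fun_prop

lemma measurableSet_halfSpace : MeasurableSet (halfSpace m) :=
  measurableSet_lt measurable_const measurable_snd

variable {m b}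

lemma integrableOn_weight (hb : Measurable b)
    (h : (∫⁻ y in halfSpace m, ENNReal.ofReal (y.2 * |b y|)) < ⊤) :
    Integrable (fun y : HalfSpacePt m => y.2 * b y) (volume.restrict (halfSpace m)) := by
  refine ⟨(measurable_snd.mul hb).aestronglyMeasurable, ?_⟩
  rw [hasFiniteIntegral_iff_norm]
  refine lt_of_le_of_lt (setLIntegral_mono' (measurableSet_halfSpace m) fun y hy => ?_) h
  rw [norm_mul, Real.norm_eq_abs, Real.norm_eq_abs, abs_of_pos (show 0 < y.2 from hy)]

lemma integrable_dirichletWeight (hb : Measurable b)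
    (h : (∫⁻ y in halfSpace m, ENNReal.ofReal (y.2 * |b y|)) < ⊤) :
    Integrable (dirichletWeight m b) (dirichletMeasure m) :=
  (integrableOn_weight hb h).comp_fst _

lemma integral_abs_dirichletWeight :
    ∫ p, |dirichletWeight m b p| ∂dirichletMeasure m =
      2 * ∫ y in halfSpace m, y.2 * |b y| := by
  unfold dirichletWeight dirichletMeasure
  rw [integral_fun_fst (fun y : HalfSpacePt m => |y.2 * b y|)]
  have : ∫ y in halfSpace m, |y.2 * b y| = ∫ y in halfSpace m, y.2 * |b y| :=
    setIntegral_congr_fun (measurableSet_halfSpace m) fun y hy => by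
      simp only [abs_mul, abs_of_pos (show 0 < y.2 from hy)]
  rw [this]
  norm_num [Measure.real]

lemma Eheat_eq_scaledConv (hb : Measurable b)
    (h : (∫⁻ y in halfSpace m, ENNReal.ofReal (y.2 * |b y|)) < ⊤) {t : ℝ} (ht : 0 < t) :
    Eheat m t b = (-((4 * Real.pi * t) ^ (-((m : ℝ) + 1) / 2) * (√t)⁻¹)) •
      scaledConv (dirichletMeasure m) (dirichletWeight m b) (dirichletPoint m) (√t)⁻¹
        (gaussSchwartzDn m) := by
  funext x
  have hint := integrable_smul_schwartz_comp (integrable_dirichletWeight hb h)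
    (measurable_dirichletPoint m).aestronglyMeasurable (√t)⁻¹ (gaussSchwartzDn m) x
  rw [Pi.smul_apply, scaledConv, dirichletMeasure, integral_prod _ hint, ← integral_smul, Eheat]
  refine integral_congr_ae (.of_forall fun y => ?_)
  simp only
  rw [gauss_sub_gauss_eq m ht, ← integral_mul_const, ← integral_smul]
  refine integral_congr_ae (.of_forall fun s => ?_)
  simp only [dirichletWeight, dirichletPoint, smul_eq_mul]
  ring

end

instance (m : ℕ) : (volume : Measure (HalfSpacePt m)).IsAddHaarMeasure :=
  Measure.prod.instIsAddHaarMeasure _ _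

lemma norm_coordVec_le (m : ℕ) (i : Fin (m + 1)) : ‖coordVec m i‖ ≤ 1 := by
  unfold coordVec
  split_ifs <;> simp [Prod.norm_def, Pi.norm_single]

lemma eLpNorm_smul_scaledConv_le {V F Ω : Type*} [NormedAddCommGroup V] [NormedSpace ℝ V]
    [NormedAddCommGroup F] [NormedSpace ℝ F] [MeasurableSpace Ω] [MeasurableSpace V]
    [BorelSpace V] [FiniteDimensional ℝ V] {μ : Measure V} [μ.IsAddHaarMeasure] {ν : Measure Ω}
    [SFinite ν] {w : Ω → ℝ} {φ : Ω → V} {q : ℝ≥0∞} (hq : 1 ≤ q) (hw : Integrable w ν)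
    (hφ : Measurable φ) {a : ℝ} (ha : 0 < a) (κ : ℝ)
    (f : 𝓢(V, F)) :
    eLpNorm (κ • scaledConv ν w φ a f) q μ ≤
      ENNReal.ofReal (|κ| * (((a ^ Module.finrank ℝ V)⁻¹) ^ q⁻¹.toReal *
        ((SchwartzMap.seminorm ℝ 0 0 f + ∫ z, ‖f z‖ ∂μ) * ∫ ω, |w ω| ∂ν))) := by
  have hL : 0 ≤ ∫ z, ‖f z‖ ∂μ := integral_nonneg fun _ => norm_nonneg _
  have hW : 0 ≤ ∫ ω, |w ω| ∂ν := integral_nonneg fun _ => abs_nonneg _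
  have hB : 0 ≤ SchwartzMap.seminorm ℝ 0 0 f := apply_nonneg _ _
  rw [eLpNorm_const_smul, ENNReal.ofReal_mul (abs_nonneg _), ← Real.norm_eq_abs, ofReal_norm]
  gcongr
  rw [ENNReal.ofReal_mul (by positivity),
    ← ENNReal.ofReal_rpow_of_nonneg (by positivity) ENNReal.toReal_nonneg]
  refine eLpNorm_le_of_enorm_le_of_lintegral_le hq ENNReal.ofReal_ne_top (fun x => ?_) ?_
  · rw [← ofReal_norm]
    refine ENNReal.ofReal_le_ofReal ((norm_scaledConv_le hw a f x).trans ?_)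
    gcongr
    linarith
  · refine (lintegral_enorm_scaledConv_le hw hφ ha f).trans ?_
    rw [← ENNReal.ofReal_mul (by positivity), mul_assoc]
    refine ENNReal.ofReal_le_ofReal ?_
    gcongr
    linarith

set_option maxSynthPendingDepth 3 in
lemma eLpNorm_apply_smul_scaledConv_le {V Ω : Type*} [NormedAddCommGroup V] [NormedSpace ℝ V]
    [MeasurableSpace Ω] [MeasurableSpace V]
    [BorelSpace V] [FiniteDimensional ℝ V] {μ : Measure V} [μ.IsAddHaarMeasure] {ν : Measure Ω}
    [SFinite ν] {w : Ω → ℝ} {φ : Ω → V} {q : ℝ≥0∞} (hq : 1 ≤ q) (hw : Integrable w ν)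
    (hφ : Measurable φ) {a : ℝ} (ha : 0 < a) (κ : ℝ) (f : 𝓢(V, V →L[ℝ] V →L[ℝ] V →L[ℝ] ℝ))
    {e₁ e₂ e₃ : V} (h₁ : ‖e₁‖ ≤ 1) (h₂ : ‖e₂‖ ≤ 1) (h₃ : ‖e₃‖ ≤ 1) :
    eLpNorm (fun x => (κ • scaledConv ν w φ a f) x e₁ e₂ e₃) q μ ≤
      ENNReal.ofReal (|κ| * (((a ^ Module.finrank ℝ V)⁻¹) ^ q⁻¹.toReal *
        ((SchwartzMap.seminorm ℝ 0 0 f + ∫ z, ‖f z‖ ∂μ) * ∫ ω, |w ω| ∂ν))) := by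
  have hnorm : ∀ x, ‖(κ • scaledConv ν w φ a f) x e₁ e₂ e₃‖ ≤
      ‖(κ • scaledConv ν w φ a f) x‖ := fun x =>
    (ContinuousLinearMap.unit_le_opNorm _ _ h₃).trans <|
      (ContinuousLinearMap.unit_le_opNorm _ _ h₂).trans <|
        ContinuousLinearMap.unit_le_opNorm _ _ h₁
  exact (eLpNorm_mono hnorm).trans (eLpNorm_smul_scaledConv_le hq hw hφ ha κ f)

lemma heat_constant_eq (m : ℕ) {t : ℝ} (ht : 0 < t) (p K I : ℝ) :
    |-((4 * Real.pi * t) ^ (-((m : ℝ) + 1) / 2) * (√t)⁻¹) * (√t)⁻¹ * (√t)⁻¹ * (√t)⁻¹| *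
        ((((√t)⁻¹ ^ (m + 1))⁻¹) ^ p * (K * (2 * I))) =
      2 * K * (4 * Real.pi) ^ (-((m : ℝ) + 1) / 2) *
        t ^ (-(2 : ℝ) - ((m : ℝ) + 1) / 2 * (1 - p)) * I := by
  have ha : (√t)⁻¹ = t ^ (-(1 / 2) : ℝ) := by
    rw [Real.rpow_neg ht.le, Real.sqrt_eq_rpow]
  have h4 : (√t)⁻¹ * (√t)⁻¹ * (√t)⁻¹ * (√t)⁻¹ = t ^ (-2 : ℝ) := by
    rw [ha, ← Real.rpow_add ht, ← Real.rpow_add ht, ← Real.rpow_add ht]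
    norm_num
  have hR : (((√t)⁻¹ ^ (m + 1))⁻¹) ^ p = t ^ (((m : ℝ) + 1) / 2 * p) := by
    rw [ha, ← Real.rpow_natCast, ← Real.rpow_mul ht.le, ← Real.rpow_neg ht.le,
      ← Real.rpow_mul ht.le]
    congr 1
    push_cast
    ring
  have hexp : t ^ (-(2 : ℝ) - ((m : ℝ) + 1) / 2 * (1 - p)) =
      t ^ (-((m : ℝ) + 1) / 2) * t ^ (-2 : ℝ) * t ^ (((m : ℝ) + 1) / 2 * p) := by
    rw [← Real.rpow_add ht, ← Real.rpow_add ht]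
    congr 1
    ring
  have habs : |-((4 * Real.pi * t) ^ (-((m : ℝ) + 1) / 2) * (√t)⁻¹) * (√t)⁻¹ * (√t)⁻¹ * (√t)⁻¹| =
      (4 * Real.pi) ^ (-((m : ℝ) + 1) / 2) * t ^ (-((m : ℝ) + 1) / 2) * t ^ (-2 : ℝ) := by
    rw [← h4, ← Real.mul_rpow (by positivity) ht.le, neg_mul, neg_mul, neg_mul, abs_neg,
      abs_of_nonneg (by positivity)]
    ring
  rw [habs, hR, hexp]
  ring

/-- for `1 ≤ q ≤ ∞` there is `C = C(n,q) > 0` such that for `t > 0` and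
`b` measurable with `∫ yₙ|b| < ∞`, all third-order partial derivatives of `E(t)b`
exist on `ℝⁿ₊` and satisfy
`‖∂_i∂_j∂_k E(t)b‖_{L^q(ℝⁿ₊)} ≤ C t^{−2 − (n/2)(1 − 1/q)} ∫ yₙ|b(y)| dy` (`n = m + 1`). -/
theorem Eheat_thirdDeriv_Lq_decay (m : ℕ) (q : ℝ≥0∞) (hq : 1 ≤ q) :
    ∃ C : ℝ, 0 < C ∧ ∀ t : ℝ, 0 < t → ∀ b : HalfSpacePt m → ℝ, Measurable b →
      (∫⁻ y in halfSpace m, ENNReal.ofReal (y.2 * |b y|)) < ⊤ →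
      (∀ x ∈ halfSpace m, DifferentiableAt ℝ (Eheat m t b) x ∧
        DifferentiableAt ℝ (fderiv ℝ (Eheat m t b)) x ∧
        DifferentiableAt ℝ (fderiv ℝ (fderiv ℝ (Eheat m t b))) x) ∧
      ∀ i j k : Fin (m + 1),
        eLpNorm
          (fun x : HalfSpacePt m =>
            fderiv ℝ (fderiv ℝ (fderiv ℝ (Eheat m t b))) x
              (coordVec m i) (coordVec m j) (coordVec m k))
          q (volume.restrict (halfSpace m)) ≤
        ENNReal.ofReal
          (C * t ^ (-(2 : ℝ) - ((m : ℝ) + 1) / 2 * (1 - q⁻¹.toReal)) *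
            ∫ y in halfSpace m, y.2 * |b y|) := by
  let f₁ := SchwartzMap.fderivCLM ℝ _ _ (gaussSchwartzDn m)
  let f₂ := SchwartzMap.fderivCLM ℝ _ _ f₁
  let f₃ := SchwartzMap.fderivCLM ℝ _ _ f₂
  let K := SchwartzMap.seminorm ℝ 0 0 f₃ + ∫ z, ‖f₃ z‖
  have hK : 0 ≤ K := add_nonneg (apply_nonneg _ _) (integral_nonneg fun _ => norm_nonneg _)
  refine ⟨2 * (K + 1) * (4 * Real.pi) ^ (-((m : ℝ) + 1) / 2), by positivity,
    fun t ht b hb hfin => ?_⟩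
  have hw := integrable_dirichletWeight hb hfin
  have hφ := measurable_dirichletPoint m
  have hφ' : AEStronglyMeasurable (dirichletPoint m) (dirichletMeasure m) :=
    hφ.aestronglyMeasurable
  have h0 := Eheat_eq_scaledConv hb hfin ht
  have h1 := fderiv_const_smul_scaledConv hw hφ' (√t)⁻¹
    (-((4 * Real.pi * t) ^ (-((m : ℝ) + 1) / 2) * (√t)⁻¹)) (gaussSchwartzDn m)
  rw [← h0] at h1
  have h2 := fderiv_const_smul_scaledConv hw hφ' (√t)⁻¹
    (-((4 * Real.pi * t) ^ (-((m : ℝ) + 1) / 2) * (√t)⁻¹) * (√t)⁻¹) f₁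
  rw [← h1] at h2
  have h3 := fderiv_const_smul_scaledConv hw hφ' (√t)⁻¹
    (-((4 * Real.pi * t) ^ (-((m : ℝ) + 1) / 2) * (√t)⁻¹) * (√t)⁻¹ * (√t)⁻¹) f₂
  rw [← h2] at h3
  refine ⟨fun x _ => ⟨?_, ?_, ?_⟩, fun i j k => ?_⟩
  · rw [h0]
    exact (differentiable_scaledConv hw hφ' _ _ x).const_smul _
  · rw [h1]
    exact (differentiable_scaledConv hw hφ' _ _ x).const_smul _
  · rw [h2]
    exact (differentiable_scaledConv hw hφ' _ _ x).const_smul _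
  refine (eLpNorm_restrict_le _ _ _ _).trans ?_
  rw [h3]
  refine (eLpNorm_apply_smul_scaledConv_le hq hw hφ (by positivity) _ f₃ (norm_coordVec_le m i)
    (norm_coordVec_le m j) (norm_coordVec_le m k)).trans ?_
  rw [integral_abs_dirichletWeight,
    show Module.finrank ℝ (HalfSpacePt m) = m + 1 by simp, heat_constant_eq m ht]
  refine ENNReal.ofReal_le_ofReal ?_
  have hI : 0 ≤ ∫ y in halfSpace m, y.2 * |b y| :=
    setIntegral_nonneg (measurableSet_halfSpace m) fun y hy =>
      mul_nonneg (le_of_lt hy) (abs_nonneg _)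
  have hK1 : K ≤ K + 1 := by linarith
  gcongr

end
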